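/- For every k ≥ 1 and every digit d in {0,...,b-1}, the total mass of k-admissible strings starting with digit d equals b^{p-1}. Consequently the total mass of k-admissible strings whose first digit is nonzero equals (b-1)b^{p-1}. -/

import Mathlib

open scoped BigOperators

/-- Number of (possibly overlapping) occurrences of the block `w` in `X`. -/
def occCount {α : Type*} [DecidableEq α] (w X : List α) : ℕ :=
  ((List.range X.length).filter fun i => (X.drop i).take w.length = w).length

/-- Number of strings of length `l` over `{0,…,b-1}` with exactly `k` occurrences of `w`
and whose first digit is `d`. -/
def NwHead (b : ℕ) (w : List (Fin b)) (d : Fin b) (k l : ℕ) : ℕ :=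
  Fintype.card {f : Fin l → Fin b //
    occCount w (List.ofFn f) = k ∧ (List.ofFn f).head? = some d}

/-- Number of strings of length `l` over `{0,…,b-1}` with exactly `k` occurrences of `w`
and whose first digit exists and is nonzero. -/
def NwHeadNZ (b : ℕ) (w : List (Fin b)) (k l : ℕ) : ℕ :=
  Fintype.card {f : Fin l → Fin b //
    occCount w (List.ofFn f) = k ∧ ∃ d : Fin b, d.val ≠ 0 ∧ (List.ofFn f).head? = some d}

open scoped ENNReal

section PrefixMass

variable {α : Type*}

/-- The total mass of a set of strings, a string `X` having weight `(card α)⁻¹ ^ |X|`. -/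
noncomputable def stringMass [Fintype α] (S : Set (List α)) : ℝ≥0∞ :=
  ∑' X : S, ((Fintype.card α : ℝ≥0∞)⁻¹) ^ (X : List α).length

section Occ

variable [DecidableEq α]

theorem occCount_nil (w : List α) : occCount w [] = 0 := by simp [occCount]

theorem occCount_cons (w : List α) (d : α) (X : List α) :
    occCount w (d :: X) = occCount w X + if w <+: d :: X then 1 else 0 := by
  have h : w <+: d :: X ↔ (d :: X).take w.length = w := by
    rw [List.prefix_iff_eq_take, eq_comm]
  simp only [occCount, List.length_cons, List.range_succ_eq_map, List.filter_cons,
    List.filter_map, h, List.drop_zero]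
  split_ifs <;> simp_all [Function.comp_def]

theorem occCount_append_le (w u X : List α) :
    occCount w (u ++ X) ≤ u.length + occCount w X := by
  induction u with
  | nil => simp
  | cons d u ih =>
    rw [List.cons_append, occCount_cons, List.length_cons]
    split_ifs <;> omega

theorem occCount_pos_of_prefix {w X : List α} (hw : w ≠ []) (h : w <+: X) :
    0 < occCount w X := by
  cases X with
  | nil => simp_all
  | cons d X => simp [occCount_cons, h]

end Occ

section Mass

variable [Fintype α]

theorem stringMass_mono {S T : Set (List α)} (h : S ⊆ T) : stringMass S ≤ stringMass T :=
  ENNReal.tsum_mono_subtype (fun X : List α => ((Fintype.card α : ℝ≥0∞)⁻¹) ^ X.length) h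

theorem stringMass_union {S T : Set (List α)} (h : Disjoint S T) :
    stringMass (S ∪ T) = stringMass S + stringMass T :=
  ENNReal.summable.tsum_union_disjoint
    (f := fun X : List α => ((Fintype.card α : ℝ≥0∞)⁻¹) ^ X.length) h ENNReal.summable

theorem stringMass_union_le (S T : Set (List α)) :
    stringMass (S ∪ T) ≤ stringMass S + stringMass T :=
  ENNReal.tsum_union_le (fun X : List α => ((Fintype.card α : ℝ≥0∞)⁻¹) ^ X.length) S T

theorem stringMass_singleton_nil : stringMass ({[]} : Set (List α)) = 1 := by
  simp [stringMass]

theorem stringMass_append_image (u : List α) (S : Set (List α)) :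
    stringMass ((u ++ ·) '' S) = ((Fintype.card α : ℝ≥0∞)⁻¹) ^ u.length * stringMass S := by
  rw [stringMass, stringMass, ← ENNReal.tsum_mul_left,
    tsum_image (f := fun X : List α => ((Fintype.card α : ℝ≥0∞)⁻¹) ^ X.length)
      (List.append_right_injective u).injOn]
  simp [pow_add]

theorem stringMass_iUnion {ι : Type*} {t : ι → Set (List α)}
    (h : Set.univ.PairwiseDisjoint t) : stringMass (⋃ i, t i) = ∑' i, stringMass (t i) :=
  ENNReal.tsum_biUnion (f := fun X : List α => ((Fintype.card α : ℝ≥0∞)⁻¹) ^ X.length) h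

theorem stringMass_cons_mem [Nonempty α] (S : Set (List α)) :
    stringMass {X | ∃ d, ∃ Y ∈ S, d :: Y = X} = stringMass S := by
  have h : {X | ∃ d, ∃ Y ∈ S, d :: Y = X} = ⋃ d : α, (([d] ++ ·) '' S) := by
    ext X; simp
  rw [h, stringMass_iUnion]
  · simp only [stringMass_append_image, tsum_fintype, Finset.sum_const, Finset.card_univ,
      nsmul_eq_mul, List.length_singleton, pow_one]
    rw [← mul_assoc, ENNReal.mul_inv_cancel (by simp) (by simp), one_mul]
  · intro d _ e _ hde
    rw [Function.onFun, Set.disjoint_left]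
    rintro _ ⟨Y, _, rfl⟩ ⟨Z, _, h⟩
    simp at h
    exact hde h.1.symm

theorem stringMass_lt_top_of_length_lt [Nonempty α] {S : Set (List α)} {n : ℕ}
    (h : ∀ X ∈ S, X.length < n) : stringMass S < ∞ := by
  have : Finite S := (List.finite_length_lt α n).subset h
  have := Fintype.ofFinite S
  rw [stringMass, tsum_fintype, ENNReal.sum_lt_top]
  intro X _
  exact ENNReal.pow_lt_top (by simp [Fintype.card_pos])

theorem stringMass_le_of_forall_length_lt {S : Set (List α)} {C : ℝ≥0∞}
    (h : ∀ n, stringMass {X | X ∈ S ∧ X.length < n} ≤ C) : stringMass S ≤ C := by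
  classical
  rw [stringMass, ENNReal.tsum_eq_iSup_sum]
  refine iSup_le fun s => ?_
  obtain ⟨n, hn⟩ : ∃ n, ∀ X ∈ s, X.1.length < n :=
    ⟨s.sup (fun X => X.1.length) + 1, fun X hX =>
      Nat.lt_succ_of_le (Finset.le_sup (f := fun X : S => X.1.length) hX)⟩
  refine le_trans ?_ (h n)
  have hs : ((s.image Subtype.val : Finset (List α)) : Set (List α)) ⊆
      {X | X ∈ S ∧ X.length < n} := by
    intro X hX
    simp only [Finset.coe_image, Set.mem_image, Finset.mem_coe] at hX
    obtain ⟨Y, hY, rfl⟩ := hX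
    exact ⟨Y.2, hn Y hY⟩
  refine le_trans (le_of_eq ?_) (stringMass_mono hs)
  rw [stringMass, Finset.tsum_subtype' (s.image Subtype.val)
    (fun X : List α => ((Fintype.card α : ℝ≥0∞)⁻¹) ^ X.length),
    Finset.sum_image Subtype.val_injective.injOn]

theorem stringMass_eq_tsum_card (P : List α → Prop) :
    stringMass {X | P X} = ∑' l : ℕ, (Nat.card {f : Fin l → α // P (List.ofFn f)} : ℝ≥0∞) *
      ((Fintype.card α : ℝ≥0∞)⁻¹) ^ l := by
  classical
  rw [stringMass, tsum_subtype {X | P X}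
    (fun X : List α => ((Fintype.card α : ℝ≥0∞)⁻¹) ^ X.length),
    ← List.equivSigmaTuple.symm.tsum_eq, ENNReal.tsum_sigma']
  congr with l
  simp [tsum_fintype, List.equivSigmaTuple, Set.indicator_apply, Finset.sum_ite,
    Fintype.card_subtype]

theorem tsum_card_eq_toReal_stringMass [Nonempty α] (P : List α → Prop) :
    ∑' l : ℕ, (Nat.card {f : Fin l → α // P (List.ofFn f)} : ℝ) *
      ((Fintype.card α : ℝ)⁻¹) ^ l = (stringMass {X | P X}).toReal := by
  rw [stringMass_eq_tsum_card, ENNReal.tsum_toReal_eq]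
  · simp
  · exact fun l => ENNReal.mul_ne_top (by simp) (ENNReal.pow_ne_top (by simp))

end Mass

section Admissible

variable [Fintype α] [DecidableEq α]

theorem stringMass_occCount_zero_prefix {w : List α} (hw : w ≠ []) :
    stringMass {X | occCount w X = 0 ∧ w <+: X} = 0 := by
  have h : {X | occCount w X = 0 ∧ w <+: X} = ∅ :=
    Set.eq_empty_of_forall_notMem fun X hX => (occCount_pos_of_prefix hw hX.2).ne' hX.1
  simp [h, stringMass]

variable [Nonempty α]

theorem stringMass_prefix_succ_le_of_length_lt (w : List α) (k n : ℕ) :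
    stringMass {X | (occCount w X = k + 1 ∧ w <+: X) ∧ X.length < n} ≤
      stringMass {X | (occCount w X = k ∧ w <+: X) ∧ X.length < n} + 1 := by
  set H : Set (List α) := {X | occCount w X = k ∧ ¬ w <+: X ∧ X ≠ [] ∧ X.length < n}
  have hH : stringMass H ≠ ∞ :=
    (stringMass_lt_top_of_length_lt (n := n) fun X hX => hX.2.2.2).ne
  refine (ENNReal.add_le_add_iff_right hH).1 ?_
  calc
    _ = stringMass ({X | (occCount w X = k + 1 ∧ w <+: X) ∧ X.length < n} ∪ H) :=
      (stringMass_union (Set.disjoint_left.2 fun X hX hX' => hX'.2.1 hX.1.2)).symm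
    _ ≤ stringMass {X | ∃ d, ∃ Y ∈ {Y | occCount w Y = k ∧ Y.length < n}, d :: Y = X} := by
      refine stringMass_mono ?_
      rintro (_ | ⟨d, Y⟩) hX
      · simp [H, occCount_nil] at hX
      · refine ⟨d, Y, ?_, rfl⟩
        simp only [H, Set.mem_union, Set.mem_ofPred_eq, occCount_cons, List.length_cons] at hX ⊢
        grind
    _ = stringMass {Y | occCount w Y = k ∧ Y.length < n} := stringMass_cons_mem _
    _ ≤ stringMass
        ({X | (occCount w X = k ∧ w <+: X) ∧ X.length < n} ∪ {[]} ∪ H) := by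
      refine stringMass_mono fun X hX => ?_
      simp only [H, Set.mem_union, Set.mem_ofPred_eq, Set.mem_singleton_iff] at hX ⊢
      tauto
    _ ≤ _ := by
      rw [← stringMass_singleton_nil (α := α)]
      exact (stringMass_union_le _ _).trans (add_le_add_left (stringMass_union_le _ _) _)

theorem stringMass_prefix_lt_top {w : List α} (hw : w ≠ []) (k : ℕ) :
    stringMass {X | occCount w X = k ∧ w <+: X} < ∞ := by
  refine (stringMass_le_of_forall_length_lt (C := k) fun n => ?_).trans_lt
    (ENNReal.natCast_lt_top k)
  induction k with
  | zero =>
    rw [Nat.cast_zero, ← stringMass_occCount_zero_prefix hw]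
    exact stringMass_mono fun X hX => hX.1
  | succ k ih =>
    rw [Nat.cast_succ]
    exact (stringMass_prefix_succ_le_of_length_lt w k n).trans (add_le_add_left ih 1)

theorem stringMass_occCount_lt_top {w : List α} (hw : w ≠ []) (k : ℕ) :
    stringMass {X | occCount w X = k} < ∞ := by
  have h : ((Fintype.card α : ℝ≥0∞)⁻¹) ^ w.length * stringMass {X | occCount w X = k} < ∞ := by
    rw [← stringMass_append_image]
    calc
      _ ≤ stringMass (⋃ j ∈ Finset.range (w.length + k + 1),
            {X | occCount w X = j ∧ w <+: X}) := by
        refine stringMass_mono ?_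
        rintro _ ⟨X, rfl, rfl⟩
        simp only [Set.mem_iUnion]
        exact ⟨_, Finset.mem_range.2 (Nat.lt_succ_of_le (occCount_append_le w w X)), rfl,
          List.prefix_append w X⟩
      _ ≤ ∑ j ∈ Finset.range (w.length + k + 1), stringMass {X | occCount w X = j ∧ w <+: X} :=
        ENNReal.tsum_biUnion_le (fun X : List α => ((Fintype.card α : ℝ≥0∞)⁻¹) ^ X.length) _ _
      _ < ∞ := ENNReal.sum_lt_top.2 fun j _ => stringMass_prefix_lt_top hw j
  refine lt_top_iff_ne_top.2 fun htop => h.ne ?_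
  rw [htop, ENNReal.mul_top]
  simp

theorem stringMass_prefix_succ {w : List α} (hw : w ≠ []) (k : ℕ) :
    stringMass {X | occCount w X = k + 1 ∧ w <+: X} =
      stringMass {X | occCount w X = k ∧ w <+: X} + if k = 0 then 1 else 0 := by
  set H : Set (List α) := {X | occCount w X = k ∧ ¬ w <+: X ∧ X ≠ []}
  have hH : stringMass H ≠ ∞ :=
    ((stringMass_mono fun X hX => hX.1).trans_lt (stringMass_occCount_lt_top hw k)).ne
  have hE : stringMass {X : List α | X = [] ∧ k = 0} = if k = 0 then 1 else 0 := by
    split_ifs with hk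
    · simpa [hk] using stringMass_singleton_nil (α := α)
    · simp [hk, stringMass]
  refine (ENNReal.add_left_inj hH).1 ?_
  rw [← hE, ← stringMass_union, ← stringMass_union, ← stringMass_union]
  · calc
      _ = stringMass {X | ∃ d, ∃ Y ∈ {Y | occCount w Y = k}, d :: Y = X} := by
        congr 1
        ext (_ | ⟨d, Y⟩)
        · simp [H, occCount_nil]
        · simp only [H, Set.mem_union, Set.mem_ofPred_eq, occCount_cons, List.cons.injEq]
          grind
      _ = stringMass {Y | occCount w Y = k} := stringMass_cons_mem _
      _ = _ := by
        congr 1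
        ext (_ | ⟨d, Y⟩)
        · simp [H, occCount_nil, hw, eq_comm]
        · simp only [H, Set.mem_union, Set.mem_ofPred_eq]
          grind
  · rw [Set.disjoint_left]
    rintro X (hX | hX) hX'
    · exact hX'.2.1 hX.2
    · exact hX'.2.2 hX.1
  · rw [Set.disjoint_left]
    rintro X hX hX'
    exact hw (List.prefix_nil.1 (hX'.1 ▸ hX.2))
  · exact Set.disjoint_left.2 fun X hX hX' => hX'.2.1 hX.2

theorem stringMass_prefix_eq_one {w : List α} (hw : w ≠ []) {k : ℕ} (hk : k ≠ 0) :
    stringMass {X | occCount w X = k ∧ w <+: X} = 1 := by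
  induction k with
  | zero => exact absurd rfl hk
  | succ k ih =>
    rw [stringMass_prefix_succ hw]
    rcases eq_or_ne k 0 with rfl | h
    · simp [stringMass_occCount_zero_prefix hw]
    · simp [ih h, h]

theorem stringMass_prefix_of_length_le {w : List α} (hw : w ≠ []) {k : ℕ} (hk : k ≠ 0)
    {v : List α} (hv : v.length ≤ w.length) :
    stringMass {X | occCount w X = k ∧ v <+: X} =
      ((Fintype.card α : ℝ≥0∞)⁻¹) ^ v.length * stringMass {X | occCount w X = k} := by
  induction v with
  | nil => simp
  | cons d v ih =>
    have hG : stringMass {X | occCount w X = k ∧ w <+: X ∧ d :: v <+: X} =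
        stringMass {X | occCount w X = k + 1 ∧ w <+: X ∧ d :: v <+: X} := by
      by_cases hvw : d :: v <+: w
      · have h (X : List α) : (w <+: X ∧ d :: v <+: X) ↔ w <+: X :=
          and_iff_left_of_imp hvw.trans
        simp only [h, stringMass_prefix_eq_one hw hk, stringMass_prefix_eq_one hw k.succ_ne_zero]
      · have h (X : List α) : ¬ (w <+: X ∧ d :: v <+: X) := fun hX =>
          hvw (List.prefix_of_prefix_length_le hX.2 hX.1 hv)
        simp only [h, and_false]
    calc
      _ = stringMass ({X | occCount w X = k ∧ w <+: X ∧ d :: v <+: X} ∪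
          {X | occCount w X = k ∧ ¬ w <+: X ∧ d :: v <+: X}) := by
        congr 1
        ext X
        simp only [Set.mem_union, Set.mem_ofPred_eq]
        tauto
      _ = stringMass ({X | occCount w X = k + 1 ∧ w <+: X ∧ d :: v <+: X} ∪
          {X | occCount w X = k ∧ ¬ w <+: X ∧ d :: v <+: X}) := by
        rw [stringMass_union, hG, stringMass_union] <;>
          exact Set.disjoint_left.2 fun X hX hX' => hX'.2.1 hX.2.1
      _ = stringMass (([d] ++ ·) '' {Y | occCount w Y = k ∧ v <+: Y}) := by
        congr 1
        ext (_ | ⟨e, Y⟩)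
        · simp
        · simp only [Set.mem_union, Set.mem_ofPred_eq, occCount_cons, Set.mem_image,
            List.cons_append, List.nil_append, List.cons.injEq, List.cons_prefix_cons]
          grind
      _ = _ := by
        rw [stringMass_append_image, ih (by simp at hv; omega), ← mul_assoc, ← pow_add,
          List.length_singleton, List.length_cons, add_comm]

theorem stringMass_occCount {w : List α} (hw : w ≠ []) {k : ℕ} (hk : k ≠ 0) :
    stringMass {X | occCount w X = k} = (Fintype.card α : ℝ≥0∞) ^ w.length := by
  have h := stringMass_prefix_of_length_le hw hk le_rfl
  rw [stringMass_prefix_eq_one hw hk, ← ENNReal.inv_pow] at h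
  rw [ENNReal.eq_inv_of_mul_eq_one_left ((mul_comm _ _).trans h.symm), inv_inv]

theorem stringMass_head {w : List α} (hw : w ≠ []) {k : ℕ} (hk : k ≠ 0) (d : α) :
    stringMass {X | occCount w X = k ∧ X.head? = some d} =
      (Fintype.card α : ℝ≥0∞) ^ (w.length - 1) := by
  have hpos := List.length_pos_iff.2 hw
  have hd (X : List α) : X.head? = some d ↔ [d] <+: X := by
    cases X <;> simp [eq_comm]
  simp only [hd]
  rw [stringMass_prefix_of_length_le (v := [d]) hw hk hpos, stringMass_occCount hw hk]
  rw [← mul_pow_sub_one hpos.ne', ← mul_assoc, List.length_singleton, pow_one,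
    ENNReal.inv_mul_cancel (by simp) (by simp), one_mul]

theorem stringMass_head_mem {w : List α} (hw : w ≠ []) {k : ℕ} (hk : k ≠ 0) (P : α → Prop) :
    stringMass {X | occCount w X = k ∧ ∃ d, P d ∧ X.head? = some d} =
      Nat.card {d // P d} * (Fintype.card α : ℝ≥0∞) ^ (w.length - 1) := by
  classical
  have h : {X | occCount w X = k ∧ ∃ d, P d ∧ X.head? = some d} =
      ⋃ d : {d // P d}, {X | occCount w X = k ∧ X.head? = some d.1} := by
    ext X
    simp only [Set.mem_iUnion, Set.mem_ofPred_eq, Subtype.exists]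
    grind
  rw [h, stringMass_iUnion]
  · simp [stringMass_head hw hk, tsum_fintype]
  · intro d _ e _ hde
    refine Set.disjoint_left.2 fun X hX hX' => hde (Subtype.ext ?_)
    exact Option.some_injective _ (hX.2.symm.trans hX'.2)

end Admissible

end PrefixMass

/-- For `k ≥ 1`, the total mass of `k`-admissible strings starting with any given digit
`d` is `b^{p-1}`; consequently the total mass of `k`-admissible strings with nonzero
first digit is `(b-1) b^{p-1}`. -/
theorem stmt12 (b : ℕ) (hb : 1 < b) (w : List (Fin b)) (hw : 1 ≤ w.length)
    (k : ℕ) (hk : 1 ≤ k) :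
    (∀ d : Fin b, ∑' l : ℕ, (NwHead b w d k l : ℝ) * ((b : ℝ)⁻¹) ^ l =
      (b : ℝ) ^ (w.length - 1)) ∧
    ∑' l : ℕ, (NwHeadNZ b w k l : ℝ) * ((b : ℝ)⁻¹) ^ l =
      ((b : ℝ) - 1) * (b : ℝ) ^ (w.length - 1) := by
  have hw' : w ≠ [] := List.length_pos_iff.1 hw
  have hk' : k ≠ 0 := Nat.one_le_iff_ne_zero.1 hk
  have : NeZero b := ⟨by omega⟩
  refine ⟨fun d => ?_, ?_⟩
  · have h := tsum_card_eq_toReal_stringMass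
      (fun X : List (Fin b) => occCount w X = k ∧ X.head? = some d)
    rw [stringMass_head hw' hk'] at h
    simpa [NwHead, Nat.card_eq_fintype_card] using h
  · have h := tsum_card_eq_toReal_stringMass
      (fun X : List (Fin b) => occCount w X = k ∧ ∃ d : Fin b, d.val ≠ 0 ∧ X.head? = some d)
    have hcard : Nat.card {d : Fin b // d.val ≠ 0} = b - 1 := by
      have hval (d : Fin b) : d.val ≠ 0 ↔ d ≠ 0 := by rw [Ne, Fin.val_eq_zero_iff]
      simp [hval, Nat.card_eq_fintype_card, Fintype.card_subtype_compl]
    rw [stringMass_head_mem hw' hk' (fun d : Fin b => d.val ≠ 0), hcard] at h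
    rw [← Nat.cast_pred (by omega)]
    simpa only [NwHeadNZ, Nat.card_eq_fintype_card, Fintype.card_fin, ENNReal.toReal_mul,
      ENNReal.toReal_pow, ENNReal.toReal_natCast] using h
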